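/- Let G be a simple graph with at least one edge, let p* ∈ (0,1] satisfy N_G(p*) = 1/2, and let p' satisfy p*/8 ≤ p' ≤ p*. Let u be a vertex of G with degree d_u := deg_G(u) ≥ 1/p', and let p_u ∈ (0,1) satisfy N_{u,G}(p_u) = e^{−1}. Then 1 − 2/e ≤ p_u · d_u ≤ 1. -/

import Mathlib

open Finset
open scoped Classical

/-- The probability that a `p`-random query (each vertex included independently with
probability `p`) equals the given finite set `Q`. -/
noncomputable def qweight {V : Type} [Fintype V] (p : ℝ) (Q : Finset V) : ℝ :=
  p ^ Q.card * (1 - p) ^ (Fintype.card V - Q.card)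

/-- The probability that a `p`-random query satisfies the event `A`. -/
noncomputable def qprob {V : Type} [Fintype V] (p : ℝ) (A : Finset V → Prop) : ℝ :=
  ∑ Q : Finset V, if A Q then qweight p Q else 0

/-- `Q` is an independent set in `G`. -/
def indepIn {V : Type} (G : SimpleGraph V) (Q : Finset V) : Prop :=
  ∀ u ∈ Q, ∀ v ∈ Q, ¬ G.Adj u v

/-- `N_G(p)`: the probability that a `p`-random query is independent in `G`. -/
noncomputable def NG {V : Type} [Fintype V] (G : SimpleGraph V) (p : ℝ) : ℝ :=
  qprob p (fun Q => indepIn G Q)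

/-- `N_{u,G}(p)`: the probability that `Q ∪ {u}` is independent in `G` for a `p`-random
query `Q`. -/
noncomputable def NuG {V : Type} [Fintype V] [DecidableEq V]
    (G : SimpleGraph V) (u : V) (p : ℝ) : ℝ :=
  qprob p (fun Q => indepIn G (insert u Q))

lemma qweight_nonneg {V : Type} [Fintype V] {p : ℝ} (hp0 : 0 ≤ p) (hp1 : p ≤ 1) (Q : Finset V) :
    0 ≤ qweight p Q := by
  have : 0 ≤ 1 - p := by linarith
  unfold qweight
  positivity

/-- The Holley condition for product measures. -/
lemma qweight_mul_qweight_le {V : Type} [Fintype V] [DecidableEq V] {p q : ℝ} (hp0 : 0 ≤ p)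
    (hpq : p ≤ q) (hq1 : q ≤ 1) (A B : Finset V) :
    qweight p A * qweight q B ≤ qweight p (A ∩ B) * qweight q (A ∪ B) := by
  obtain ⟨k, hk⟩ := Nat.exists_eq_add_of_le (card_le_card (inter_subset_left : A ∩ B ⊆ A))
  have hAB := card_union_add_card_inter A B
  have hU : (A ∪ B).card = B.card + k := by omega
  obtain ⟨m, hm⟩ := Nat.exists_eq_add_of_le (card_le_univ (A ∪ B))
  obtain ⟨l, hl⟩ := Nat.exists_eq_add_of_le (card_le_univ A)
  have h1 : Fintype.card V - A.card = l := by omega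
  have h2 : Fintype.card V - B.card = m + k := by omega
  have h3 : Fintype.card V - (A ∩ B).card = l + k := by omega
  have h4 : Fintype.card V - (A ∪ B).card = m := by omega
  have hq0 : 0 ≤ q := hp0.trans hpq
  have hp1 : 0 ≤ 1 - p := by linarith
  have hq1' : 0 ≤ 1 - q := by linarith
  have key : (p * (1 - q)) ^ k ≤ ((1 - p) * q) ^ k :=
    pow_le_pow_left₀ (by positivity) (by nlinarith) k
  rw [qweight, qweight, qweight, qweight, h1, h2, h3, h4, hk, hU]
  calc p ^ ((A ∩ B).card + k) * (1 - p) ^ l * (q ^ B.card * (1 - q) ^ (m + k))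
      = (p ^ (A ∩ B).card * (1 - p) ^ l * q ^ B.card * (1 - q) ^ m) * (p * (1 - q)) ^ k := by
        rw [mul_pow]
        ring
    _ ≤ (p ^ (A ∩ B).card * (1 - p) ^ l * q ^ B.card * (1 - q) ^ m) * ((1 - p) * q) ^ k := by
        gcongr
    _ = _ := by
        rw [mul_pow]
        ring

lemma qprob_disjoint {V : Type} [Fintype V] [DecidableEq V] (p : ℝ) (S : Finset V) :
    qprob p (fun Q => Disjoint Q S) = (1 - p) ^ S.card := by
  have hS : S.card + Sᶜ.card = Fintype.card V := card_add_card_compl S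
  have hfilter : univ.filter (fun Q : Finset V => Disjoint Q S) = Sᶜ.powerset := by
    ext Q
    simp [subset_compl_iff_disjoint_right]
  calc qprob p (fun Q => Disjoint Q S)
      = ∑ Q ∈ Sᶜ.powerset, qweight p Q := by
        rw [← hfilter, sum_filter, qprob]
        exact sum_congr rfl fun Q _ => by split_ifs <;> rfl
    _ = ∑ Q ∈ Sᶜ.powerset, (1 - p) ^ S.card * (p ^ Q.card * (1 - p) ^ (Sᶜ.card - Q.card)) := by
        refine sum_congr rfl fun Q hQ => ?_
        have hQ' := card_le_card (mem_powerset.1 hQ)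
        rw [qweight, show Fintype.card V - Q.card = S.card + (Sᶜ.card - Q.card) by omega]
        ring
    _ = (1 - p) ^ S.card := by
        rw [← mul_sum, sum_pow_mul_eq_add_pow]
        simp

lemma sum_qweight {V : Type} [Fintype V] [DecidableEq V] (p : ℝ) :
    ∑ Q : Finset V, qweight p Q = 1 := by
  simpa [qprob] using qprob_disjoint p (∅ : Finset V)

lemma qprob_mono {V : Type} [Fintype V] {p : ℝ} (hp0 : 0 ≤ p) (hp1 : p ≤ 1)
    {A B : Finset V → Prop} (hAB : ∀ Q, A Q → B Q) : qprob p A ≤ qprob p B := by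
  refine sum_le_sum fun Q _ => ?_
  have := qweight_nonneg hp0 hp1 Q
  by_cases hA : A Q
  · simp [hA, hAB Q hA]
  · rw [if_neg hA]
    split_ifs <;> simp [this]

/-- Harris' inequality for decreasing events, combined with their monotonicity in the
parameter of the query. -/
lemma qprob_mul_qprob_le {V : Type} [Fintype V] [DecidableEq V] {p q : ℝ} (hp0 : 0 ≤ p)
    (hpq : p ≤ q) (hq1 : q ≤ 1) {A B : Finset V → Prop}
    (hA : ∀ Q R : Finset V, Q ⊆ R → A R → A Q) (hB : ∀ Q R : Finset V, Q ⊆ R → B R → B Q) :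
    qprob p A * qprob q B ≤ qprob p (fun Q => A Q ∧ B Q) := by
  have hp1 := hpq.trans hq1
  have hq0 := hp0.trans hpq
  have h := four_functions_theorem_univ
    (f₁ := fun Q : Finset V => if A Q then qweight p Q else 0)
    (f₂ := fun Q : Finset V => if B Q then qweight q Q else 0)
    (f₃ := fun Q : Finset V => if A Q ∧ B Q then qweight p Q else 0)
    (f₄ := fun Q : Finset V => qweight q Q)
    (fun Q => by dsimp; split_ifs <;> simp [qweight_nonneg hp0 hp1])
    (fun Q => by dsimp; split_ifs <;> simp [qweight_nonneg hq0 hq1])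
    (fun Q => by dsimp; split_ifs <;> simp [qweight_nonneg hp0 hp1])
    (fun Q => qweight_nonneg hq0 hq1 Q)
    (fun Q R => by
      have hnn : 0 ≤ (if A (Q ∩ R) ∧ B (Q ∩ R) then qweight p (Q ∩ R) else 0) *
          qweight q (Q ∪ R) := by
        refine mul_nonneg ?_ (qweight_nonneg hq0 hq1 _)
        split_ifs <;> simp [qweight_nonneg hp0 hp1]
      by_cases hAQ : A Q
      · by_cases hBR : B R
        · have hAB : A (Q ∩ R) ∧ B (Q ∩ R) :=
            ⟨hA _ _ inter_subset_left hAQ, hB _ _ inter_subset_right hBR⟩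
          simpa [hAQ, hBR, hAB] using qweight_mul_qweight_le hp0 hpq hq1 Q R
        · simpa [hBR] using hnn
      · simpa [hAQ] using hnn)
  rw [sum_qweight, mul_one] at h
  refine h.trans_eq (sum_congr rfl fun Q _ => ?_)
  dsimp only
  split_ifs <;> rfl

lemma indepIn_insert_iff {V : Type} [DecidableEq V] (G : SimpleGraph V) (u : V)
    [Fintype (G.neighborSet u)] (Q : Finset V) :
    indepIn G (insert u Q) ↔ Disjoint Q (G.neighborFinset u) ∧ indepIn G Q := by
  simp only [indepIn, mem_insert, forall_eq_or_imp, disjoint_left, SimpleGraph.mem_neighborFinset,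
    SimpleGraph.irrefl, not_false_eq_true, true_and]
  exact ⟨fun h => ⟨fun v hv => h.1 v hv, fun v hv => (h.2 v hv).2⟩,
    fun h => ⟨fun v hv => h.1 v hv, fun v hv => ⟨fun hvu => h.1 v hv hvu.symm, h.2 v hv⟩⟩⟩

theorem stmt19 {V : Type} [Fintype V] [DecidableEq V]
    (G : SimpleGraph V) [DecidableRel G.Adj] (hE : ∃ a b : V, G.Adj a b)
    (pstar p' : ℝ) (hps0 : 0 < pstar) (hps1 : pstar ≤ 1) (hN : NG G pstar = 1 / 2)
    (hp'l : pstar / 8 ≤ p') (hp'u : p' ≤ pstar)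
    (u : V) (hdu : 1 / p' ≤ (G.degree u : ℝ))
    (pu : ℝ) (hpu0 : 0 < pu) (hpu1 : pu < 1)
    (hNu : NuG G u pu = Real.exp (-1)) :
    1 - 2 / Real.exp 1 ≤ pu * (G.degree u : ℝ) ∧ pu * (G.degree u : ℝ) ≤ 1 := by
  have hN' : NuG G u pu = qprob pu
      (fun Q => Disjoint Q (G.neighborFinset u) ∧ indepIn G Q) := by
    simp only [NuG, indepIn_insert_iff]
  have hdisj := qprob_disjoint pu (G.neighborFinset u)
  rw [SimpleGraph.card_neighborFinset_eq_degree] at hdisj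
  have upper : pu * (G.degree u : ℝ) ≤ 1 := by
    have h1 : Real.exp (-1) ≤ (1 - pu) ^ G.degree u := by
      rw [← hNu, hN', ← hdisj]
      exact qprob_mono hpu0.le hpu1.le fun Q hQ => hQ.1
    have h2 : (1 - pu) ^ G.degree u ≤ Real.exp (-(pu * (G.degree u : ℝ))) := by
      calc (1 - pu) ^ G.degree u ≤ Real.exp (-pu) ^ G.degree u :=
            pow_le_pow_left₀ (by linarith) (Real.one_sub_le_exp_neg pu) _
        _ = Real.exp (-(pu * (G.degree u : ℝ))) := by
            rw [← Real.exp_nat_mul]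
            ring_nf
    have := Real.exp_le_exp.1 (h1.trans h2)
    linarith
  refine ⟨?_, upper⟩
  have hp'0 : 0 < p' := by linarith
  have hpu_le : pu ≤ pstar := by
    have h1 : pu * (1 / p') ≤ 1 := (mul_le_mul_of_nonneg_left hdu hpu0.le).trans upper
    rw [mul_one_div, div_le_one hp'0] at h1
    exact h1.trans hp'u
  have h := qprob_mul_qprob_le hpu0.le hpu_le hps1
    (A := fun Q => Disjoint Q (G.neighborFinset u)) (B := indepIn G)
    (fun Q R hQR hR => hR.mono_left hQR)
    (fun Q R hQR hR a ha b hb => hR a (hQR ha) b (hQR hb))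
  rw [← hN', hNu, hdisj, show qprob pstar (indepIn G) = 1 / 2 from hN, Real.exp_neg] at h
  have hbern := one_add_mul_le_pow (show (-2 : ℝ) ≤ -pu by linarith) (G.degree u)
  rw [← sub_eq_add_neg] at hbern
  rw [div_eq_mul_inv]
  linarith
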